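/- Let $M^n$, $n \geq 3$, be an $n$-dimensional submanifold of an $m$-dimensional, $m \geq 4$, conformally flat Riemannian manifold $(\widetilde{M}^m, \widetilde{g})$. Then $\rho + \rho^{\perp} \leq \Vert H \Vert^2 + \frac{2}{n(m-2)} \sum_{j=1}^n \widetilde{Ric}(e_j, e_j) - \frac{2\widetilde{\tau}}{(m-1)(m-2)}$, where $\{e_j\}_{1 \leq j \leq n}$ is a local orthonormal frame of the tangent bundle of $M^n$. -/

import Mathlib

open Finset Matrix

/-- Kronecker delta (the components of the metric in an orthonormal frame). -/
noncomputable def kdelta {k : ℕ} (a b : Fin k) : ℝ := if a = b then 1 else 0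

/-- The scalar curvature `tau = sum_{i<j} R(e_i, e_j, e_j, e_i)` computed from the
components of the curvature tensor in an orthonormal frame. -/
noncomputable def scalarCurv {n : ℕ} (R : Fin n → Fin n → Fin n → Fin n → ℝ) : ℝ :=
  ∑ i : Fin n, ∑ j : Fin n, if i < j then R i j j i else 0

/-- The normalized scalar curvature `rho = 2 tau / (n (n - 1))`. -/
noncomputable def normScalarCurv {n : ℕ} (R : Fin n → Fin n → Fin n → Fin n → ℝ) : ℝ :=
  2 * scalarCurv R / ((n : ℝ) * ((n : ℝ) - 1))

/-- The normal scalar curvature `K_N = -(1/4) sum_{r,s} trace ([A_r, A_s]^2)` computed from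
the shape operators (given as symmetric matrices in an orthonormal tangent frame). -/
noncomputable def KN {n p : ℕ} (A : Fin p → Matrix (Fin n) (Fin n) ℝ) : ℝ :=
  -(1 / 4) * ∑ r : Fin p, ∑ s : Fin p,
    Matrix.trace ((A r * A s - A s * A r) * (A r * A s - A s * A r))

/-- The normalized normal scalar curvature `rho_N = (2/(n(n-1))) sqrt(K_N)`. -/
noncomputable def rhoN {n p : ℕ} (A : Fin p → Matrix (Fin n) (Fin n) ℝ) : ℝ :=
  2 / ((n : ℝ) * ((n : ℝ) - 1)) * Real.sqrt (KN A)

/-- The squared mean curvature `|H|^2 = sum_r ((1/n) trace A_r)^2` computed from the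
components of the second fundamental form in adapted orthonormal frames. -/
noncomputable def meanCurvSq {n p : ℕ} (A : Fin p → Matrix (Fin n) (Fin n) ℝ) : ℝ :=
  ∑ r : Fin p, ((1 / (n : ℝ)) * ∑ i : Fin n, A r i i) ^ 2

/-- The normalized normal scalar curvature
`rho^perp = (2/(n(n-1))) sqrt( sum_{i<j} sum_{r<s} (Rperp(e_i,e_j,v_r,v_s))^2 )`
computed from the components of the normal curvature tensor. -/
noncomputable def rhoPerp {n p : ℕ} (Rp : Fin n → Fin n → Fin p → Fin p → ℝ) : ℝ :=
  2 / ((n : ℝ) * ((n : ℝ) - 1)) *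
    Real.sqrt (∑ i : Fin n, ∑ j : Fin n, ∑ r : Fin p, ∑ s : Fin p,
      if i < j ∧ r < s then Rp i j r s ^ 2 else 0)

/-- The Ricci curvature `Ric(e_b, e_c) = sum_a R(e_a, e_b, e_c, e_a)` computed from the
components of the curvature tensor in an orthonormal frame. -/
noncomputable def ambRicci {m : ℕ} (Rt : Fin m → Fin m → Fin m → Fin m → ℝ)
    (b c : Fin m) : ℝ :=
  ∑ a : Fin m, Rt a b c a

/-- The (ambient) scalar curvature `tau = sum_{a<b} sigma(e_a, e_b) = (1/2) sum_a Ric(e_a,e_a)`. -/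
noncomputable def ambScalar {m : ℕ} (Rt : Fin m → Fin m → Fin m → Fin m → ℝ) : ℝ :=
  (1 / 2) * ∑ a : Fin m, ambRicci Rt a a

section RealVectors

variable {ι : Type*} [Fintype ι] [DecidableEq ι]

/-- Two disjoint pairs of coordinates of a vector of norm at most one cannot both be more than
one apart. -/
theorem not_disjoint_gaps {η : ι → ℝ} (hη : ∑ i, η i ^ 2 ≤ 1) {a b c d : ι}
    (hab : 1 < η a - η b) (hcd : 1 < η c - η d) (hac : a ≠ c) (had : a ≠ d) (hbc : b ≠ c)
    (hbd : b ≠ d) : False := by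
  have hab' : a ≠ b := by rintro rfl; linarith
  have hcd' : c ≠ d := by rintro rfl; linarith
  have hsub : ∑ i ∈ ({a, b, c, d} : Finset ι), η i ^ 2 ≤ ∑ i, η i ^ 2 :=
    sum_le_sum_of_subset_of_nonneg (subset_univ _) fun i _ _ => sq_nonneg _
  rw [sum_insert (by simp [*]), sum_insert (by simp [*]), sum_insert (by simp [*]),
    sum_singleton] at hsub
  nlinarith [sq_nonneg (η a + η b), sq_nonneg (η c + η d)]

/-- In a vector of norm at most one, all the pairs of coordinates more than one apart share a
common coordinate. -/
theorem exists_common_gap_index [Nonempty ι] {η : ι → ℝ} (hη : ∑ i, η i ^ 2 ≤ 1) :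
    ∃ p, ∀ u v, 1 < η u - η v → u = p ∨ v = p := by
  obtain ⟨p, hp⟩ := Finite.exists_max η
  obtain ⟨q, hq⟩ := Finite.exists_min η
  by_contra! hcon
  obtain ⟨u, v, huv, hup, -⟩ := hcon p
  obtain ⟨u', v', huv', -, hvq'⟩ := hcon q
  have hpq : 1 < η p - η q := by linarith [hp u, hq v]
  have hv : v = q := by
    by_contra hvq
    refine not_disjoint_gaps hη huv hpq hup ?_ ?_ hvq
    · rintro rfl; linarith [hq v]
    · rintro rfl; linarith [hp u]
  have hu' : u' = p := by
    by_contra hup'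
    refine not_disjoint_gaps hη huv' hpq hup' ?_ ?_ hvq'
    · rintro rfl; linarith [hq v']
    · rintro rfl; linarith [hp u']
  subst hv hu'
  have hne : u' ≠ v := by rintro rfl; linarith
  by_cases huv'' : u = v'
  · subst huv''
    have hsub : ∑ i ∈ ({u', v} : Finset ι), η i ^ 2 ≤ ∑ i, η i ^ 2 :=
      sum_le_sum_of_subset_of_nonneg (subset_univ _) fun i _ _ => sq_nonneg _
    rw [sum_pair hne] at hsub
    nlinarith [sq_nonneg (η u' + η v)]
  · exact not_disjoint_gaps hη huv huv' hup huv'' hne.symm hvq'.symm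

/-- The squared gaps from a fixed coordinate exceed one by at most one in total. -/
theorem sum_gap_excess_star_le {η : ι → ℝ} (hη : ∑ i, η i ^ 2 ≤ 1) (p : ι) :
    ∑ v, max ((η p - η v) ^ 2 - 1) 0 ≤ 1 := by
  set L : Finset ι := univ.filter fun v => 1 < (η p - η v) ^ 2 with hL
  have hsum : ∑ v, max ((η p - η v) ^ 2 - 1) 0 = ∑ v ∈ L, ((η p - η v) ^ 2 - 1) := by
    rw [hL, sum_filter]
    refine sum_congr rfl fun v _ => ?_
    split_ifs with hv
    · exact max_eq_left (by linarith)
    · exact max_eq_right (by linarith)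
  have hpL : p ∉ L := by simp [hL]
  have hsub : ∑ i ∈ insert p L, η i ^ 2 ≤ ∑ i, η i ^ 2 :=
    sum_le_sum_of_subset_of_nonneg (subset_univ _) fun i _ _ => sq_nonneg _
  rw [sum_insert hpL] at hsub
  have hcs := sq_sum_le_card_mul_sum_sq (s := L) (f := η)
  have hexp : ∑ v ∈ L, ((η p - η v) ^ 2 - 1)
      = #L * η p ^ 2 - 2 * η p * ∑ v ∈ L, η v + ∑ v ∈ L, η v ^ 2 - #L := by
    have : ∀ v, (η p - η v) ^ 2 - 1 = η p ^ 2 - 2 * η p * η v + η v ^ 2 - 1 := fun v => by ring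
    simp only [this, sum_sub_distrib, sum_add_distrib, ← mul_sum, sum_const, nsmul_eq_mul, mul_one]
  rw [hsum, hexp]
  have hk : (0 : ℝ) ≤ #L := Nat.cast_nonneg _
  nlinarith [sq_nonneg (η p + ∑ v ∈ L, η v)]

/-- The squared gaps exceed one by at most one in total, each pair being counted twice. -/
theorem sum_gap_excess_le {η : ι → ℝ} (hη : ∑ i, η i ^ 2 ≤ 1) :
    ∑ u, ∑ v, max ((η u - η v) ^ 2 - 1) 0 ≤ 2 := by
  cases isEmpty_or_nonempty ι
  · simp
  obtain ⟨p, hp⟩ := exists_common_gap_index hη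
  set g : ι → ι → ℝ := fun u v => max ((η u - η v) ^ 2 - 1) 0 with hg
  have hg0 : ∀ u v, 0 ≤ g u v := fun u v => le_max_right _ _
  have hgs : ∀ u v, g u v = g v u := fun u v => by simp only [hg]; congr 2; ring
  have hle : ∀ u v, g u v ≤ (if u = p then g p v else 0) + if v = p then g p u else 0 := by
    intro u v
    by_cases hu : u = p
    · subst hu
      simp only [if_true]
      split_ifs <;> linarith [hg0 u u]
    · by_cases hv : v = p
      · subst hv
        simp [hu, hgs u v]
      · simp only [hu, hv, if_false, add_zero, hg]
        refine max_le ?_ le_rfl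
        have h1 : ¬ 1 < η u - η v := fun h => (hp u v h).elim hu hv
        have h2 : ¬ 1 < η v - η u := fun h => (hp v u h).elim hv hu
        nlinarith
  calc ∑ u, ∑ v, g u v
      ≤ ∑ u, ∑ v, ((if u = p then g p v else 0) + if v = p then g p u else 0) :=
        sum_le_sum fun u _ => sum_le_sum fun v _ => hle u v
    _ = ∑ v, g p v + ∑ v, g p v := by
        simp only [sum_add_distrib]
        congr 1
        · rw [sum_comm]; simp
        · simp
    _ ≤ 2 := by linarith [sum_gap_excess_star_le hη p]

end RealVectors

theorem sum_rotate {α β γ : Type*} [Fintype α] [Fintype β] [Fintype γ] (f : α → β → γ → ℝ) :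
    ∑ a, ∑ b, ∑ c, f a b c = ∑ c, ∑ a, ∑ b, f a b c :=
  (sum_congr rfl fun _ _ => sum_comm).trans sum_comm

section Frobenius

variable {ι κ : Type*} [Fintype ι]

/-- The Frobenius inner product of two real matrices. -/
def frob (X Y : Matrix ι ι ℝ) : ℝ := (Xᵀ * Y).trace

theorem frob_eq_sum (X Y : Matrix ι ι ℝ) : frob X Y = ∑ i, ∑ j, X i j * Y i j := by
  rw [sum_comm]
  simp [frob, Matrix.trace, Matrix.mul_apply]

theorem frob_self_eq_sum (X : Matrix ι ι ℝ) : frob X X = ∑ i, ∑ j, X i j ^ 2 := by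
  simp only [frob_eq_sum, sq]

theorem frob_self_nonneg (X : Matrix ι ι ℝ) : 0 ≤ frob X X := by
  rw [frob_self_eq_sum]
  positivity

theorem eq_zero_of_frob_self_eq_zero {X : Matrix ι ι ℝ} (hX : frob X X = 0) : X = 0 := by
  rw [frob_self_eq_sum, sum_eq_zero_iff_of_nonneg fun i _ => by positivity] at hX
  ext i j
  have := hX i (mem_univ i)
  rw [sum_eq_zero_iff_of_nonneg fun i _ => by positivity] at this
  simpa using this j (mem_univ j)

theorem frob_smul_smul (a b : ℝ) (X Y : Matrix ι ι ℝ) :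
    frob (a • X) (b • Y) = a * b * frob X Y := by
  simp only [frob, transpose_smul, Matrix.smul_mul, Matrix.mul_smul, trace_smul, smul_eq_mul]
  ring

theorem frob_neg_neg (X Y : Matrix ι ι ℝ) : frob (-X) (-Y) = frob X Y := by
  simp [frob]

theorem frob_conj [DecidableEq ι] {U : Matrix ι ι ℝ} (hU : U * Uᵀ = 1) (X Y : Matrix ι ι ℝ) :
    frob (Uᵀ * X * U) (Uᵀ * Y * U) = frob X Y := by
  have hexp : (Uᵀ * X * U)ᵀ * (Uᵀ * Y * U) = Uᵀ * (Xᵀ * (U * Uᵀ) * Y * U) := by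
    simp only [transpose_mul, transpose_transpose, Matrix.mul_assoc]
  rw [frob, frob, hexp, hU, trace_mul_comm, Matrix.mul_assoc, hU]
  simp

/-- Bessel's inequality for an off-diagonal entry of an orthonormal family of symmetric matrices. -/
theorem sum_sq_entry_le_half [DecidableEq κ] {J : Finset κ} {B : κ → Matrix ι ι ℝ}
    (hB : ∀ s ∈ J, (B s).IsSymm)
    (hON : ∀ s ∈ J, ∀ t ∈ J, frob (B s) (B t) = if s = t then 1 else 0) {p q : ι} (hpq : p ≠ q) :
    ∑ s ∈ J, B s p q ^ 2 ≤ 1 / 2 := by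
  classical
  set w := ∑ s ∈ J, B s p q ^ 2 with hw
  set X : Matrix ι ι ℝ := ∑ s ∈ J, B s p q • B s with hX
  have hXX : frob X X = w := by
    have : frob X X = ∑ s ∈ J, ∑ t ∈ J, B s p q * B t p q * frob (B s) (B t) := by
      simp only [← frob_smul_smul]
      simp only [hX, frob, transpose_sum, Matrix.sum_mul, Matrix.mul_sum, trace_sum]
      exact sum_comm
    rw [this, hw]
    refine sum_congr rfl fun s hs => ?_
    rw [sum_congr rfl fun t ht => by rw [hON s hs t ht]]
    simp [hs, sq]
  have hpqX : X p q = w := by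
    simp [hX, hw, Matrix.sum_apply, sq]
  have hqpX : X q p = w := by
    rw [← hpqX]
    simp only [hX, Matrix.sum_apply, Matrix.smul_apply]
    exact sum_congr rfl fun s hs => by rw [(hB s hs).apply]
  have hge : X p q ^ 2 + X q p ^ 2 ≤ frob X X := by
    rw [frob_self_eq_sum, ← sum_product']
    have hne : (p, q) ≠ (q, p) := by simp [hpq]
    rw [← sum_pair (f := fun x : ι × ι => X x.1 x.2 ^ 2) hne]
    exact sum_le_sum_of_subset_of_nonneg (subset_univ _) fun i _ _ => sq_nonneg _
  rw [hXX, hpqX, hqpX] at hge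
  nlinarith

/-- An orthonormal family of symmetric matrices, bracketed with a diagonal matrix of norm one,
gains at most one in total squared norm. -/
theorem sum_frob_lie_diagonal_le [DecidableEq ι] [DecidableEq κ] {J : Finset κ}
    {B : κ → Matrix ι ι ℝ} (hB : ∀ s ∈ J, (B s).IsSymm)
    (hON : ∀ s ∈ J, ∀ t ∈ J, frob (B s) (B t) = if s = t then 1 else 0)
    {η : ι → ℝ} (hη : ∑ i, η i ^ 2 ≤ 1) :
    ∑ s ∈ J, (frob ⁅diagonal η, B s⁆ ⁅diagonal η, B s⁆ - 1) ≤ 1 := by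
  have hterm : ∀ s ∈ J, frob ⁅diagonal η, B s⁆ ⁅diagonal η, B s⁆ - 1
      = ∑ p, ∑ q, ((η p - η q) ^ 2 - 1) * B s p q ^ 2 := by
    intro s hs
    have h1 : frob (B s) (B s) = 1 := by simp [hON s hs s hs]
    conv_lhs => rw [← h1]
    rw [frob_self_eq_sum, frob_self_eq_sum (B s), ← sum_sub_distrib]
    refine sum_congr rfl fun p _ => ?_
    rw [← sum_sub_distrib]
    refine sum_congr rfl fun q _ => ?_
    rw [Ring.lie_def, Matrix.sub_apply, diagonal_mul, mul_diagonal]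
    ring
  rw [sum_congr rfl hterm, sum_comm]
  have hle : ∀ p q, ∑ s ∈ J, ((η p - η q) ^ 2 - 1) * B s p q ^ 2
      ≤ max ((η p - η q) ^ 2 - 1) 0 * (1 / 2) := by
    intro p q
    rw [← mul_sum]
    have h0 : 0 ≤ ∑ s ∈ J, B s p q ^ 2 := sum_nonneg fun s _ => sq_nonneg _
    by_cases hpq : p = q
    · subst hpq
      simpa using h0
    · exact (mul_le_mul_of_nonneg_right (le_max_left _ 0) h0).trans
        (mul_le_mul_of_nonneg_left (sum_sq_entry_le_half hB hON hpq) (le_max_right _ _))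
  calc ∑ p, ∑ s ∈ J, ∑ q, ((η p - η q) ^ 2 - 1) * B s p q ^ 2
      ≤ ∑ p, ∑ q, max ((η p - η q) ^ 2 - 1) 0 * (1 / 2) := by
        refine sum_le_sum fun p _ => ?_
        rw [sum_comm]
        exact sum_le_sum fun q _ => hle p q
    _ ≤ 1 := by
        simp only [← sum_mul]
        linarith [sum_gap_excess_le hη]

/-- Every real symmetric matrix is orthogonally diagonalizable. -/
theorem exists_orthogonal_diagonalization [DecidableEq ι] {A : Matrix ι ι ℝ} (hA : A.IsSymm) :
    ∃ (U : Matrix ι ι ℝ) (η : ι → ℝ), U * Uᵀ = 1 ∧ Uᵀ * A * U = diagonal η := by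
  have hH : A.IsHermitian := by
    rw [IsHermitian, conjTranspose_eq_transpose_of_trivial]; exact hA
  have h1 := Unitary.mul_star_self_of_mem hH.eigenvectorUnitary.2
  have h3 := hH.conjStarAlgAut_star_eigenvectorUnitary
  rw [star_eq_conjTranspose, conjTranspose_eq_transpose_of_trivial] at h1
  refine ⟨hH.eigenvectorUnitary, hH.eigenvalues, h1, ?_⟩
  rw [Unitary.conjStarAlgAut_star_apply] at h3
  simpa [star_eq_conjTranspose, conjTranspose_eq_transpose_of_trivial, Function.comp_def] using h3

theorem sum_frob_lie_le [DecidableEq ι] [DecidableEq κ] {J : Finset κ} {A : Matrix ι ι ℝ}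
    (hA : A.IsSymm) (hA1 : frob A A = 1) {B : κ → Matrix ι ι ℝ} (hB : ∀ s ∈ J, (B s).IsSymm)
    (hON : ∀ s ∈ J, ∀ t ∈ J, frob (B s) (B t) = if s = t then 1 else 0) :
    ∑ s ∈ J, (frob ⁅A, B s⁆ ⁅A, B s⁆ - 1) ≤ 1 := by
  obtain ⟨U, η, hU, hη⟩ := exists_orthogonal_diagonalization hA
  have hη1 : ∑ i, η i ^ 2 ≤ 1 := by
    rw [← hA1, ← frob_conj hU, hη, frob_self_eq_sum]
    refine sum_le_sum fun i _ => ?_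
    rw [sum_eq_single i (fun j _ hj => by simp [diagonal_apply_ne _ hj.symm]) (by simp)]
    simp
  have key := sum_frob_lie_diagonal_le (J := J) (B := fun s => Uᵀ * B s * U)
    (fun s hs => by
      have := hB s hs
      unfold IsSymm at this ⊢
      simp [transpose_mul, this, Matrix.mul_assoc])
    (fun s hs t ht => by rw [frob_conj hU, hON s hs t ht]) hη1
  refine le_of_eq_of_le (sum_congr rfl fun s _ => ?_) key
  have hlie : ⁅diagonal η, Uᵀ * B s * U⁆ = Uᵀ * ⁅A, B s⁆ * U := by
    have hmul : ∀ X Y : Matrix ι ι ℝ, Uᵀ * X * U * (Uᵀ * Y * U) = Uᵀ * (X * Y) * U := by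
      intro X Y
      calc Uᵀ * X * U * (Uᵀ * Y * U) = Uᵀ * X * (U * Uᵀ) * Y * U := by
            simp only [Matrix.mul_assoc]
        _ = Uᵀ * (X * Y) * U := by rw [hU]; simp only [Matrix.mul_one, Matrix.mul_assoc]
    rw [← hη, Ring.lie_def, Ring.lie_def, hmul, hmul, Matrix.mul_sub, Matrix.sub_mul]
  rw [hlie, frob_conj hU]

theorem frob_lie_comm (X Y : Matrix ι ι ℝ) : frob ⁅X, Y⁆ ⁅X, Y⁆ = frob ⁅Y, X⁆ ⁅Y, X⁆ := by
  rw [Ring.lie_def, Ring.lie_def, ← frob_neg_neg, neg_sub]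

/-- The excess of the bracket of two matrices over the product of their squared norms, relative
to that product. -/
noncomputable def lieExcess (X Y : Matrix ι ι ℝ) : ℝ :=
  max (frob ⁅X, Y⁆ ⁅X, Y⁆ / (frob X X * frob Y Y) - 1) 0

theorem lieExcess_comm (X Y : Matrix ι ι ℝ) : lieExcess X Y = lieExcess Y X := by
  rw [lieExcess, lieExcess, frob_lie_comm, mul_comm (frob X X)]

theorem frob_lie_le_lieExcess (X Y : Matrix ι ι ℝ) :
    frob ⁅X, Y⁆ ⁅X, Y⁆ ≤ (1 + lieExcess X Y) * (frob X X * frob Y Y) := by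
  rcases eq_or_ne (frob X X * frob Y Y) 0 with h0 | h0
  · rw [h0, mul_zero]
    rcases mul_eq_zero.1 h0 with h | h
    · rw [eq_zero_of_frob_self_eq_zero h]; simp [Ring.lie_def, frob]
    · rw [eq_zero_of_frob_self_eq_zero h]; simp [Ring.lie_def, frob]
  · have hpos : 0 < frob X X * frob Y Y :=
      lt_of_le_of_ne (mul_nonneg (frob_self_nonneg _) (frob_self_nonneg _)) h0.symm
    rw [← div_le_iff₀ hpos]
    linarith [le_max_left (frob ⁅X, Y⁆ ⁅X, Y⁆ / (frob X X * frob Y Y) - 1) 0,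
      show lieExcess X Y = max (frob ⁅X, Y⁆ ⁅X, Y⁆ / (frob X X * frob Y Y) - 1) 0 from rfl]

theorem sum_lieExcess_le [DecidableEq ι] [Fintype κ] [DecidableEq κ] {A : Matrix ι ι ℝ}
    (hA : A.IsSymm) {B : κ → Matrix ι ι ℝ} (hB : ∀ s, (B s).IsSymm)
    (horth : ∀ s t, s ≠ t → frob (B s) (B t) = 0) : ∑ s, lieExcess A (B s) ≤ 1 := by
  set J : Finset κ :=
    univ.filter fun s => 1 < frob ⁅A, B s⁆ ⁅A, B s⁆ / (frob A A * frob (B s) (B s)) with hJ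
  have hsum : ∑ s, lieExcess A (B s)
      = ∑ s ∈ J, (frob ⁅A, B s⁆ ⁅A, B s⁆ / (frob A A * frob (B s) (B s)) - 1) := by
    rw [hJ, sum_filter]
    refine sum_congr rfl fun s _ => ?_
    rw [lieExcess]
    split_ifs with hs
    · exact max_eq_left (by linarith)
    · exact max_eq_right (by linarith)
  rw [hsum]
  rcases (frob_self_nonneg A).eq_or_lt with hA0 | hA0
  · have hJ0 : J = ∅ := by
      rw [hJ, filter_eq_empty_iff]
      intro s _
      rw [← hA0]
      simp
    simp [hJ0]
  have hBpos : ∀ s ∈ J, 0 < frob (B s) (B s) := by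
    intro s hs
    refine lt_of_le_of_ne (frob_self_nonneg _) fun h0 => ?_
    rw [hJ, mem_filter, ← h0] at hs
    norm_num at hs
  have hnorm : ∀ x : ℝ, 0 < x → (√x)⁻¹ * (√x)⁻¹ * x = 1 := by
    intro x hx
    rw [← mul_inv, Real.mul_self_sqrt hx.le, inv_mul_cancel₀ hx.ne']
  have key := sum_frob_lie_le (J := J) (A := (√(frob A A))⁻¹ • A)
    (B := fun s => (√(frob (B s) (B s)))⁻¹ • B s) (hA.smul _)
    (by rw [frob_smul_smul, hnorm _ hA0]) (fun s _ => (hB s).smul _)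
    (fun s hs t ht => by
      rw [frob_smul_smul]
      split_ifs with hst
      · rw [← hst, hnorm _ (hBpos s hs)]
      · rw [horth s t hst, mul_zero])
  refine le_of_eq_of_le (sum_congr rfl fun s hs => ?_) key
  have hlie : ∀ a b : ℝ, ⁅a • A, b • B s⁆ = (a * b) • ⁅A, B s⁆ := by
    intro a b
    simp only [Ring.lie_def, Matrix.smul_mul, Matrix.mul_smul, smul_smul, smul_sub, mul_comm b a]
  rw [hlie, frob_smul_smul, mul_mul_mul_comm, ← mul_inv, ← mul_inv,
    Real.mul_self_sqrt (frob_self_nonneg _), Real.mul_self_sqrt (frob_self_nonneg _), ← mul_inv,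
    div_eq_inv_mul]

theorem sum_frob_lie_le_sq_of_orthogonal [DecidableEq ι] [Fintype κ] [DecidableEq κ]
    {A : κ → Matrix ι ι ℝ} (hA : ∀ s, (A s).IsSymm)
    (horth : ∀ s t, s ≠ t → frob (A s) (A t) = 0) :
    ∑ r, ∑ s, frob ⁅A r, A s⁆ ⁅A r, A s⁆ ≤ (∑ r, frob (A r) (A r)) ^ 2 := by
  set x : κ → ℝ := fun r => frob (A r) (A r) with hx
  set d : κ → κ → ℝ := fun r s => lieExcess (A r) (A s) with hd
  have hd0 : ∀ r s, 0 ≤ d r s := fun r s => le_max_right _ _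
  have hrow : ∀ r, ∑ s, d r s ≤ 1 := fun r => sum_lieExcess_le (hA r) hA horth
  have hle : ∀ r s, frob ⁅A r, A s⁆ ⁅A r, A s⁆
      ≤ x r * x s - (if r = s then x r ^ 2 else 0)
        + (d r s * x r ^ 2 / 2 + d s r * x s ^ 2 / 2) := by
    intro r s
    have hds : d s r = d r s := lieExcess_comm _ _
    rw [hds]
    split_ifs with hrs
    · subst hrs
      have h0 : frob ⁅A r, A r⁆ ⁅A r, A r⁆ = 0 := by simp [frob, Ring.lie_def]
      nlinarith [mul_nonneg (hd0 r r) (sq_nonneg (x r))]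
    · have := frob_lie_le_lieExcess (A r) (A s)
      change _ ≤ (1 + d r s) * (x r * x s) at this
      nlinarith [mul_nonneg (hd0 r s) (sq_nonneg (x r - x s))]
  have hdiag : ∑ r, ∑ s, d r s * x r ^ 2 / 2 ≤ ∑ r, x r ^ 2 / 2 := by
    refine sum_le_sum fun r _ => ?_
    rw [← sum_div, ← sum_mul]
    nlinarith [mul_le_mul_of_nonneg_right (hrow r) (sq_nonneg (x r))]
  calc ∑ r, ∑ s, frob ⁅A r, A s⁆ ⁅A r, A s⁆
      ≤ ∑ r, ∑ s, (x r * x s - (if r = s then x r ^ 2 else 0)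
          + (d r s * x r ^ 2 / 2 + d s r * x s ^ 2 / 2)) :=
        sum_le_sum fun r _ => sum_le_sum fun s _ => hle r s
    _ = (∑ r, x r) ^ 2 - ∑ r, x r ^ 2
          + (∑ r, ∑ s, d r s * x r ^ 2 / 2 + ∑ r, ∑ s, d r s * x r ^ 2 / 2) := by
        simp only [sum_add_distrib, sum_sub_distrib]
        congr 1
        · rw [sq, sum_mul_sum]; simp
        · congr 1
          exact sum_comm
    _ ≤ (∑ r, x r) ^ 2 := by
        rw [← sum_div] at hdiag
        linarith

/-- The **DDVV inequality** for families of real symmetric matrices. -/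
theorem sum_frob_lie_le_sq [DecidableEq ι] [Fintype κ] [DecidableEq κ] {A : κ → Matrix ι ι ℝ}
    (hA : ∀ s, (A s).IsSymm) :
    ∑ r, ∑ s, frob ⁅A r, A s⁆ ⁅A r, A s⁆ ≤ (∑ r, frob (A r) (A r)) ^ 2 := by
  set G : Matrix κ κ ℝ := of fun r s => frob (A r) (A s) with hG
  have hGs : G.IsSymm := by
    ext r s
    simp only [hG, transpose_apply, of_apply, frob_eq_sum, mul_comm]
  obtain ⟨U, x, hU, hx⟩ := exists_orthogonal_diagonalization hGs
  set A' : κ → Matrix ι ι ℝ := fun r => ∑ a, U a r • A a with hA'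
  have hGram : ∀ r s, frob (A' r) (A' s) = (Uᵀ * G * U) r s := by
    intro r s
    have h1 : frob (A' r) (A' s) = ∑ b, ∑ a, frob (U a r • A a) (U b s • A b) := by
      simp only [hA', frob, transpose_sum, Matrix.sum_mul, Matrix.mul_sum, trace_sum]
    simp only [h1, frob_smul_smul, Matrix.mul_apply, sum_mul, transpose_apply, hG, of_apply]
    exact sum_congr rfl fun b _ => sum_congr rfl fun a _ => by ring
  have hA's : ∀ s, (A' s).IsSymm := by
    intro s
    simp only [IsSymm, hA', transpose_sum, transpose_smul, (hA _).eq]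
  have key := sum_frob_lie_le_sq_of_orthogonal hA's fun s t hst => by
    rw [hGram, hx, diagonal_apply_ne _ hst]
  have hnorm : ∑ r, frob (A' r) (A' r) = ∑ r, frob (A r) (A r) := by
    simp only [hGram]
    change (Uᵀ * G * U).trace = G.trace
    rw [trace_mul_comm, ← Matrix.mul_assoc, hU, Matrix.one_mul]
  have hbracket : ∀ i j, ∑ r, ∑ s, ⁅A' r, A' s⁆ i j ^ 2 = ∑ r, ∑ s, ⁅A r, A s⁆ i j ^ 2 := by
    intro i j
    set F : Matrix κ κ ℝ := of fun r s => ⁅A r, A s⁆ i j with hF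
    have hentry : ∀ r s, ⁅A' r, A' s⁆ i j = (Uᵀ * F * U) r s := by
      intro r s
      have h1 : ⁅A' r, A' s⁆ = ∑ b, ∑ a, (U a r * U b s) • ⁅A a, A b⁆ := by
        simp only [hA', Ring.lie_def, Matrix.sum_mul, Matrix.mul_sum, Matrix.smul_mul,
          Matrix.mul_smul, smul_sub, sum_sub_distrib, smul_sum, smul_smul]
        congr 1
        · exact sum_congr rfl fun a _ => sum_congr rfl fun b _ => by rw [mul_comm]
        · exact sum_comm
      simp only [h1, Matrix.sum_apply, Matrix.smul_apply, smul_eq_mul, Matrix.mul_apply, sum_mul,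
        transpose_apply, hF, of_apply]
      exact sum_congr rfl fun b _ => sum_congr rfl fun a _ => by ring
    simp only [hentry]
    rw [← frob_self_eq_sum, frob_conj hU, frob_self_eq_sum]
    rfl
  have hswap : ∀ C : κ → Matrix ι ι ℝ, ∑ r, ∑ s, frob ⁅C r, C s⁆ ⁅C r, C s⁆
      = ∑ i, ∑ j, ∑ r, ∑ s, ⁅C r, C s⁆ i j ^ 2 := by
    intro C
    simp only [frob_self_eq_sum]
    rw [sum_rotate]
    exact sum_congr rfl fun i _ => sum_rotate _
  rw [hnorm, hswap] at key
  rw [hswap]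
  simpa only [hbracket] using key

/-- The DDVV inequality for the traceless parts of a family of real symmetric matrices. -/
theorem sum_frob_lie_le_sq_traceless [DecidableEq ι] [Nonempty ι] [Fintype κ] [DecidableEq κ]
    {A : κ → Matrix ι ι ℝ} (hA : ∀ s, (A s).IsSymm) :
    ∑ r, ∑ s, frob ⁅A r, A s⁆ ⁅A r, A s⁆
      ≤ (∑ r, (frob (A r) (A r) - (A r).trace ^ 2 / Fintype.card ι)) ^ 2 := by
  have hι : (Fintype.card ι : ℝ) ≠ 0 := Nat.cast_ne_zero.2 Fintype.card_ne_zero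
  set c : κ → ℝ := fun r => (A r).trace / Fintype.card ι with hc
  have key := sum_frob_lie_le_sq (A := fun r => A r - c r • 1)
    fun s => (hA s).sub (isSymm_one.smul _)
  have hlie : ∀ r s, ⁅A r - c r • (1 : Matrix ι ι ℝ), A s - c s • (1 : Matrix ι ι ℝ)⁆
      = ⁅A r, A s⁆ := by
    intro r s
    simp only [Ring.lie_def, Matrix.mul_sub, Matrix.sub_mul, Matrix.smul_mul, Matrix.mul_smul,
      Matrix.one_mul, Matrix.mul_one]
    module
  have hnorm : ∀ r, frob (A r - c r • (1 : Matrix ι ι ℝ)) (A r - c r • (1 : Matrix ι ι ℝ))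
      = frob (A r) (A r) - (A r).trace ^ 2 / Fintype.card ι := by
    intro r
    simp only [frob, transpose_sub, transpose_smul, transpose_one, Matrix.mul_sub, Matrix.sub_mul,
      Matrix.smul_mul, Matrix.mul_smul, Matrix.one_mul, Matrix.mul_one, trace_sub, trace_smul,
      trace_transpose, trace_one, smul_eq_mul, hc]
    field_simp
    ring
  simpa only [hlie, hnorm] using key

end Frobenius

theorem sum_sum_eq_two_mul_sum_lt {n : ℕ} {f : Fin n → Fin n → ℝ} (hsymm : ∀ i j, f i j = f j i)
    (hdiag : ∀ i, f i i = 0) :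
    ∑ i, ∑ j, f i j = 2 * ∑ i, ∑ j, if i < j then f i j else 0 := by
  have hsplit : ∀ i j, f i j = (if i < j then f i j else 0) + if j < i then f j i else 0 := by
    intro i j
    rcases lt_trichotomy i j with hij | rfl | hij
    · simp [hij, hij.not_gt]
    · simp [hdiag]
    · simp [hij, hij.not_gt, hsymm i j]
  conv_lhs => enter [2, i, 2, j]; rw [hsplit i j]
  simp only [sum_add_distrib]
  rw [sum_comm (f := fun i j => if j < i then f j i else 0), two_mul]

/-- The DDVV inequality with the brackets summed over ordered pairs of indices. -/
theorem sqrt_sum_lie_entries_le {n p : ℕ} [NeZero n] {A : Fin p → Matrix (Fin n) (Fin n) ℝ}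
    (hA : ∀ r, (A r).IsSymm) :
    √(∑ i, ∑ j, ∑ r, ∑ s, if i < j ∧ r < s then ((A r * A s - A s * A r) j i) ^ 2 else 0)
      ≤ (∑ r, (frob (A r) (A r) - (A r).trace ^ 2 / n)) / 2 := by
  set f : Fin n → Fin n → Fin p → Fin p → ℝ := fun i j r s => ((A r * A s - A s * A r) j i) ^ 2
    with hf
  have hij : ∀ i j r s, f i j r s = f j i r s := by
    intro i j r s
    have htr : (A r * A s - A s * A r)ᵀ = -(A r * A s - A s * A r) := by
      rw [transpose_sub, transpose_mul, transpose_mul, (hA r).eq, (hA s).eq, neg_sub]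
    have hji := congrFun (congrFun htr i) j
    rw [transpose_apply, Matrix.neg_apply] at hji
    simp only [hf]
    rw [hji, neg_sq]
  have hii : ∀ i r s, f i i r s = 0 := by
    intro i r s
    have : (A r * A s - A s * A r) i i = 0 := by
      rw [Matrix.sub_apply, Matrix.mul_apply, Matrix.mul_apply, sub_eq_zero]
      exact sum_congr rfl fun k _ => by rw [(hA r).apply k i, (hA s).apply k i, mul_comm]
    simp only [hf, this]
    norm_num
  have hrs : ∀ i j r s, f i j r s = f i j s r := by
    intro i j r s
    simp only [hf, Matrix.sub_apply]
    ring
  have hrr : ∀ i j r, f i j r r = 0 := by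
    intro i j r
    simp [hf]
  have hsum : ∑ r, ∑ s, frob ⁅A r, A s⁆ ⁅A r, A s⁆
      = 4 * ∑ i, ∑ j, ∑ r, ∑ s, if i < j ∧ r < s then f i j r s else 0 := by
    calc ∑ r, ∑ s, frob ⁅A r, A s⁆ ⁅A r, A s⁆
        = ∑ i, ∑ j, ∑ r, ∑ s, f i j r s := by
          simp only [frob_self_eq_sum]
          rw [sum_rotate, sum_congr rfl fun i _ => sum_rotate _, sum_comm]
          rfl
      _ = 2 * ∑ i, ∑ j, if i < j then ∑ r, ∑ s, f i j r s else 0 :=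
          sum_sum_eq_two_mul_sum_lt (fun i j => by simp only [hij i j]) (fun i => by simp [hii])
      _ = 2 * ∑ i, ∑ j, 2 * ∑ r, ∑ s, if i < j ∧ r < s then f i j r s else 0 := by
          congr 1
          refine sum_congr rfl fun i _ => sum_congr rfl fun j _ => ?_
          by_cases hlt : i < j
          · simp only [hlt, true_and, if_true]
            exact sum_sum_eq_two_mul_sum_lt (hrs i j) (hrr i j)
          · simp [hlt]
      _ = _ := by
          simp only [← mul_sum]
          ring
  have key := sum_frob_lie_le_sq_traceless hA
  rw [hsum, Fintype.card_fin] at key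
  have hnonneg : 0 ≤ ∑ r, (frob (A r) (A r) - (A r).trace ^ 2 / n) := by
    refine sum_nonneg fun r _ => ?_
    have hn : (0 : ℝ) < n := Nat.cast_pos.2 (NeZero.pos n)
    rw [sub_nonneg, div_le_iff₀ hn, mul_comm]
    have hcs := sq_sum_le_card_mul_sum_sq (s := univ) (f := fun i => A r i i)
    rw [card_univ, Fintype.card_fin] at hcs
    refine hcs.trans (mul_le_mul_of_nonneg_left ?_ hn.le)
    rw [frob_self_eq_sum]
    exact sum_le_sum fun i _ => single_le_sum (f := fun j => A r i j ^ 2)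
      (fun j _ => sq_nonneg _) (mem_univ i)
  refine Real.sqrt_le_iff.2 ⟨by positivity, ?_⟩
  linarith

/-- **Generalized Wintgen inequality for `ρ^⊥` (Theorem).**
Let `M^n` (`n ≥ 3`) be a submanifold of an `m`-dimensional (`m ≥ 4`) conformally flat
Riemannian manifold; `Rperp` denotes the components of the normal curvature tensor,
related to the shape operators by the Ricci equation (hypothesis `ricci`).  Then
`ρ + ρ^⊥ ≤ ‖H‖² + (2/(n(m-2))) ∑_j Ric~(e_j,e_j) - 2τ~/((m-1)(m-2))`. -/
theorem wintgen_rhoPerp_conformally_flat {n m : ℕ} (hn : 3 ≤ n) (hm : 4 ≤ m) (hnm : n ≤ m)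
    (Rt : Fin m → Fin m → Fin m → Fin m → ℝ)
    (R : Fin n → Fin n → Fin n → Fin n → ℝ)
    (h : Fin (m - n) → Matrix (Fin n) (Fin n) ℝ)
    (hsymm : ∀ r, (h r).IsSymm)
    (Rperp : Fin n → Fin n → Fin (m - n) → Fin (m - n) → ℝ)
    (ricci : ∀ (i j : Fin n) (r s : Fin (m - n)),
      Rperp i j r s = (h r * h s - h s * h r) j i)
    (weyl : ∀ x y z w : Fin m, Rt x y z w =
      (1 / ((m : ℝ) - 2)) *
        (ambRicci Rt y z * kdelta x w - ambRicci Rt x z * kdelta y w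
          + ambRicci Rt x w * kdelta y z - ambRicci Rt y w * kdelta x z)
      - (2 * ambScalar Rt / (((m : ℝ) - 1) * ((m : ℝ) - 2))) *
          (kdelta y z * kdelta x w - kdelta x z * kdelta y w))
    (gauss : ∀ i j k l : Fin n, R i j k l =
      Rt (Fin.castLE hnm i) (Fin.castLE hnm j) (Fin.castLE hnm k) (Fin.castLE hnm l)
      + ∑ r : Fin (m - n), (h r i l * h r j k - h r i k * h r j l)) :
    normScalarCurv R + rhoPerp Rperp ≤ meanCurvSq h
      + 2 / ((n : ℝ) * ((m : ℝ) - 2)) *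
          ∑ j : Fin n, ambRicci Rt (Fin.castLE hnm j) (Fin.castLE hnm j)
      - 2 * ambScalar Rt / (((m : ℝ) - 1) * ((m : ℝ) - 2)) := by
  have : NeZero n := ⟨by omega⟩
  have hn0 : (0 : ℝ) < n := by positivity
  have hn1 : (0 : ℝ) < (n : ℝ) - 1 := by
    have : (3 : ℝ) ≤ n := by exact_mod_cast hn
    linarith
  have hm2 : (0 : ℝ) < (m : ℝ) - 2 := by
    have : (4 : ℝ) ≤ m := by exact_mod_cast hm
    linarith
  set c : ℝ := 2 * ambScalar Rt / (((m : ℝ) - 1) * ((m : ℝ) - 2))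
  set ric : Fin n → ℝ := fun j => ambRicci Rt (Fin.castLE hnm j) (Fin.castLE hnm j) with hric
  have hsec : ∀ i j, R i j j i = 1 / ((m : ℝ) - 2) * (ric i + ric j) - c
      - (if i = j then 1 / ((m : ℝ) - 2) * (2 * ric i) - c else 0)
      + ∑ r, (h r i i * h r j j - h r i j ^ 2) := by
    intro i j
    rw [gauss, weyl]
    congr 1
    · by_cases hij : i = j
      · subst hij
        simp only [kdelta, if_true, hric]
        ring
      · have h1 : Fin.castLE hnm i ≠ Fin.castLE hnm j := by simpa using hij
        simp only [kdelta, hij, h1, h1.symm, if_true, if_false, hric]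
        ring
    · exact sum_congr rfl fun r _ => by rw [(hsymm r).apply i j, sq]
  have hscal : 2 * scalarCurv R = 1 / ((m : ℝ) - 2) * (2 * ((n : ℝ) - 1) * ∑ j, ric j)
      - n * ((n : ℝ) - 1) * c + ∑ r, ((h r).trace ^ 2 - frob (h r) (h r)) := by
    rw [scalarCurv, ← sum_sum_eq_two_mul_sum_lt (f := fun i j => R i j j i)]
    · simp only [hsec, sum_add_distrib, sum_sub_distrib, ← mul_sum, sum_const, card_univ,
        Fintype.card_fin, nsmul_eq_mul, sum_ite_eq, mem_univ, if_true]
      have hextr : ∑ i, ∑ j, ∑ r, h r i i * h r j j = ∑ r, (h r).trace ^ 2 := by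
        rw [sum_rotate]
        exact sum_congr rfl fun r _ => by rw [Matrix.trace, sq, sum_mul_sum]; rfl
      have hfrob : ∑ i, ∑ j, ∑ r, h r i j ^ 2 = ∑ r, frob (h r) (h r) := by
        rw [sum_rotate]
        exact sum_congr rfl fun r _ => (frob_self_eq_sum _).symm
      rw [hextr, hfrob]
      ring
    · intro i j
      rw [hsec, hsec]
      congr 1
      · by_cases hij : i = j
        · rw [hij]
        · rw [if_neg hij, if_neg (Ne.symm hij)]
          ring
      · exact sum_congr rfl fun r _ => by rw [(hsymm r).apply i j, mul_comm]
    · intro i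
      rw [hsec]
      simp [sq]
      ring
  have hmean : meanCurvSq h = (∑ r, (h r).trace ^ 2) / (n : ℝ) ^ 2 := by
    rw [meanCurvSq, sum_div]
    refine sum_congr rfl fun r _ => ?_
    rw [one_div, mul_pow, inv_pow, ← div_eq_inv_mul]
    rfl
  have hperp : rhoPerp Rperp ≤ 2 / ((n : ℝ) * ((n : ℝ) - 1)) *
      ((∑ r, (frob (h r) (h r) - (h r).trace ^ 2 / n)) / 2) := by
    rw [rhoPerp]
    simp only [ricci]
    exact mul_le_mul_of_nonneg_left (sqrt_sum_lie_entries_le hsymm) (by positivity)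
  rw [normScalarCurv, hscal, hmean]
  refine (add_le_add_right hperp _).trans (le_of_eq ?_)
  simp only [sum_sub_distrib, ← sum_div]
  field_simp
  ring
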